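/- The form ⟨,⟩_λ is alternating: ⟨y, x⟩_λ = −⟨x, y⟩_λ for all x, y ∈ C⁺(V). -/

import Mathlib

open CliffordAlgebra

set_option synthInstance.maxHeartbeats 1000000
set_option maxHeartbeats 2000000

noncomputable section

variable (n : ℕ) (a : Fin (n + 2) → ℚ)

/-- The quadratic form `Q(x) = -a₁x₁² - a₂x₂² + a₃x₃² + ⋯ + a_{n+2}x_{n+2}²` on `V = ℚ^{n+2}`. -/
def Qf : QuadraticForm ℚ (Fin (n + 2) → ℚ) :=
  QuadraticMap.weightedSumSquares ℚ (fun i => if (i : ℕ) < 2 then -a i else a i)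

/-- The standard basis vectors `eᵢ` of `V`, viewed inside the Clifford algebra `C(V)`. -/
def e (i : Fin (n + 2)) : CliffordAlgebra (Qf n a) := ι (Qf n a) (Pi.single i 1)

/-- The even Clifford algebra `C⁺(V)`. -/
abbrev Cplus : Subalgebra ℚ (CliffordAlgebra (Qf n a)) := even (Qf n a)

/-- The reversal anti-automorphism `τ`, restricted to the even Clifford algebra. -/
def tau (x : Cplus n a) : Cplus n a :=
  ⟨reverse (Q := Qf n a) (x : CliffordAlgebra (Qf n a)), by
    have hx : (x : CliffordAlgebra (Qf n a)) ∈ evenOdd (Qf n a) 0 := x.2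
    exact (reverse_mem_evenOdd_iff (Q := Qf n a)).mpr hx⟩

/-- `tr z` is the trace of the ℚ-linear endomorphism `x ↦ z * x` of `C⁺(V)`. -/
def tr (z : Cplus n a) : ℚ := LinearMap.trace ℚ (Cplus n a) (LinearMap.mulLeft ℚ z)

/-- `λ := e₁e₂ ∈ C⁺(V)`. -/
def lam : Cplus n a := ⟨e n a 0 * e n a 1, ι_mul_ι_mem_evenOdd_zero (Qf n a) _ _⟩

/-- `λ⁻¹ = -(a₁a₂)⁻¹·λ`. -/
def lamInv : Cplus n a := (-(a 0 * a 1)⁻¹) • lam n a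


/-- The bilinear form `⟨x,y⟩_λ := tr(λ·τ(x)·y)` on `C⁺(V)`. -/
def form (x y : Cplus n a) : ℚ := tr n a (lam n a * tau n a x * y)

/-- `eᵢeⱼ` as an element of `C⁺(V)`. -/
def ee (i j : Fin (n + 2)) : Cplus n a :=
  ⟨e n a i * e n a j, ι_mul_ι_mem_evenOdd_zero (Qf n a) _ _⟩

lemma Qf_single (i : Fin (n + 2)) :
    Qf n a (Pi.single i 1) = if (i : ℕ) < 2 then -a i else a i := by
  rw [Qf, QuadraticMap.weightedSumSquares_apply, Finset.sum_eq_single i]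
  · simp
  · intro b _ hb
    simp [Pi.single_apply, hb]
  · simp

lemma e_anti {i j : Fin (n + 2)} (h : i ≠ j) : e n a i * e n a j = -(e n a j * e n a i) := by
  apply ι_mul_ι_comm_of_isOrtho
  rw [QuadraticMap.isOrtho_def, Qf_single, Qf_single, Qf,
    QuadraticMap.weightedSumSquares_apply, Finset.sum_eq_add i j h]
  · simp [h, h.symm]
  · intro c _ hc
    simp [Pi.single_apply, hc.1, hc.2]
  · simp
  · simp

lemma e_sign (i j : Fin (n + 2)) :
    e n a i * e n a j = e n a j * e n a i ∨ e n a i * e n a j = -(e n a j * e n a i) := by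
  by_cases h : i = j
  · subst h; left; rfl
  · right; exact e_anti n a h

lemma iota_eq (v : Fin (n + 2) → ℚ) : ι (Qf n a) v = ∑ i, v i • e n a i := by
  conv_lhs => rw [pi_eq_sum_univ' v]
  simp only [map_sum, map_smul, e]

/-- Elements that commute or anticommute with every `eᵢ`. -/
def Mset : Set (Cplus n a) :=
  {m | ∀ i, e n a i * (m : CliffordAlgebra (Qf n a)) = m * e n a i ∨
    e n a i * (m : CliffordAlgebra (Qf n a)) = -(m * e n a i)}

lemma comm_sign_mul {A : Type*} [Ring A] {x y z : A} (h1 : x * y = y * x ∨ x * y = -(y * x))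
    (h2 : x * z = z * x ∨ x * z = -(z * x)) :
    x * (y * z) = y * z * x ∨ x * (y * z) = -(y * z * x) := by
  rw [← mul_assoc]
  rcases h1 with h1 | h1 <;> rcases h2 with h2 | h2 <;> rw [h1] <;>
    simp only [neg_mul, mul_assoc, h2, mul_neg, neg_neg, true_or, or_true]

lemma ee_mul_mem {x : Cplus n a} (hx : x ∈ Submodule.span ℚ (Mset n a)) (i j : Fin (n + 2)) :
    ee n a i j * x ∈ Submodule.span ℚ (Mset n a) := by
  induction hx using Submodule.span_induction with
  | mem m hm =>
    apply Submodule.subset_span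
    intro k
    exact comm_sign_mul (comm_sign_mul (e_sign n a k i) (e_sign n a k j)) (hm k)
  | zero => simp
  | add x y _ _ hx hy => rw [mul_add]; exact add_mem hx hy
  | smul c x _ hx => rw [mul_smul_comm]; exact Submodule.smul_mem _ _ hx

lemma iota_mul_iota (v w : Fin (n + 2) → ℚ) :
    ι (Qf n a) v * ι (Qf n a) w = ((∑ i, ∑ j, (v i * w j) • ee n a i j : Cplus n a) :
      CliffordAlgebra (Qf n a)) := by
  rw [iota_eq, iota_eq, Finset.sum_mul_sum]
  simp [ee, smul_smul, mul_comm]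

lemma mem_span_M (x : Cplus n a) : x ∈ Submodule.span ℚ (Mset n a) := by
  obtain ⟨x, hx⟩ := x
  refine even_induction (Qf n a)
    (motive := fun x hx => (⟨x, hx⟩ : Cplus n a) ∈ Submodule.span ℚ (Mset n a)) ?_ ?_ ?_ x hx
  · intro r
    have : (1 : Cplus n a) ∈ Submodule.span ℚ (Mset n a) :=
      Submodule.subset_span fun i => by simp
    convert Submodule.smul_mem _ r this using 1
    ext
    simp [Algebra.algebraMap_eq_smul_one]
  · intro x y hx hy h1 h2
    exact add_mem h1 h2
  · intro v w x hx h
    have : (∑ i, ∑ j, (v i * w j) • (ee n a i j * ⟨x, hx⟩) : Cplus n a) ∈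
        Submodule.span ℚ (Mset n a) :=
      sum_mem fun i _ => sum_mem fun j _ => Submodule.smul_mem _ _ (ee_mul_mem n a h i j)
    convert this using 1
    apply Subtype.ext
    change ι (Qf n a) v * ι (Qf n a) w * x = _
    rw [iota_mul_iota]
    simp [Finset.sum_mul]

/-- Difference of left and right traces. -/
def fdiff : Cplus n a →ₗ[ℚ] ℚ :=
  LinearMap.trace ℚ (Cplus n a) ∘ₗ (LinearMap.mul ℚ (Cplus n a)) -
    LinearMap.trace ℚ (Cplus n a) ∘ₗ (LinearMap.mul ℚ (Cplus n a)).flip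

lemma trL_comm (x y : Cplus n a) : LinearMap.trace ℚ (Cplus n a) (LinearMap.mulLeft ℚ (x * y)) =
    LinearMap.trace ℚ (Cplus n a) (LinearMap.mulLeft ℚ (y * x)) := by
  rw [LinearMap.mulLeft_mul, LinearMap.mulLeft_mul]
  exact LinearMap.trace_mul_comm ℚ _ _

lemma trR_comm (x y : Cplus n a) : LinearMap.trace ℚ (Cplus n a) (LinearMap.mulRight ℚ (x * y)) =
    LinearMap.trace ℚ (Cplus n a) (LinearMap.mulRight ℚ (y * x)) := by
  rw [LinearMap.mulRight_mul, LinearMap.mulRight_mul]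
  exact LinearMap.trace_mul_comm ℚ _ _

lemma fdiff_apply (x : Cplus n a) : fdiff n a x =
    LinearMap.trace ℚ (Cplus n a) (LinearMap.mulLeft ℚ x) -
    LinearMap.trace ℚ (Cplus n a) (LinearMap.mulRight ℚ x) := rfl

lemma fdiff_comm (x y : Cplus n a) : fdiff n a (x * y) = fdiff n a (y * x) := by
  rw [fdiff_apply, fdiff_apply, trL_comm, trR_comm]

lemma e_sq (i : Fin (n + 2)) : e n a i * e n a i =
    algebraMap ℚ _ (if (i : ℕ) < 2 then -a i else a i) := by
  rw [← Qf_single]; exact ι_sq_scalar _ _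

lemma ee_ee (i j : Fin (n + 2)) : ee n a i j * ee n a j i =
    ((if (i : ℕ) < 2 then -a i else a i) * (if (j : ℕ) < 2 then -a j else a j)) •
      (1 : Cplus n a) := by
  apply Subtype.ext
  change e n a i * e n a j * (e n a j * e n a i) = _ • (1 : CliffordAlgebra (Qf n a))
  rw [mul_assoc, ← mul_assoc (e n a j), e_sq, Algebra.commutes, ← mul_assoc, e_sq, ← map_mul,
    Algebra.algebraMap_eq_smul_one]

lemma fdiff_M (ha : ∀ i, 0 < a i) (m : Cplus n a) (hm : m ∈ Mset n a) : fdiff n a m = 0 := by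
  by_cases h : ∀ i j, ee n a i j * m = m * ee n a i j
  · have hc : ∀ x : Cplus n a, x * m = m * x := by
      rintro ⟨x, hx⟩
      refine even_induction (Qf n a)
        (motive := fun x hx => (⟨x, hx⟩ : Cplus n a) * m = m * ⟨x, hx⟩) ?_ ?_ ?_ x hx
      · intro r
        exact Algebra.commutes r m
      · intro x y hx hy h1 h2
        have := congrArg₂ (· + ·) h1 h2
        simp only [← add_mul, ← mul_add] at this
        exact this
      · intro v w x hx h1
        have h2 : (∑ i, ∑ j, (v i * w j) • ee n a i j : Cplus n a) * m =
            m * (∑ i, ∑ j, (v i * w j) • ee n a i j : Cplus n a) := by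
          simp only [Finset.sum_mul, Finset.mul_sum, smul_mul_assoc, mul_smul_comm, h]
        have h3 := congrArg Subtype.val h2
        have h4 := congrArg Subtype.val h1
        apply Subtype.ext
        simp only [Subalgebra.coe_mul] at h3 h4
        rw [← iota_mul_iota] at h3
        change ι (Qf n a) v * ι (Qf n a) w * x * m.1 = m.1 * (ι (Qf n a) v * ι (Qf n a) w * x)
        rw [mul_assoc, h4, ← mul_assoc, h3, mul_assoc]
    rw [fdiff_apply, sub_eq_zero]
    congr 1
    ext1 x
    exact (hc x).symm
  · push Not at h
    obtain ⟨i, j, hij⟩ := h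
    have hs : ee n a i j * m = -(m * ee n a i j) := by
      have h1 : (m : CliffordAlgebra (Qf n a)) * e n a i = e n a i * m ∨
          (m : CliffordAlgebra (Qf n a)) * e n a i = -(e n a i * m) := by
        rcases hm i with h | h
        · left; rw [h]
        · right; rw [h, neg_neg]
      have h2 : (m : CliffordAlgebra (Qf n a)) * e n a j = e n a j * m ∨
          (m : CliffordAlgebra (Qf n a)) * e n a j = -(e n a j * m) := by
        rcases hm j with h | h
        · left; rw [h]
        · right; rw [h, neg_neg]
      rcases comm_sign_mul h1 h2 with h | h
      · exact absurd (Subtype.ext h.symm) hij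
      · apply Subtype.ext
        change e n a i * e n a j * m.1 = -(m.1 * (e n a i * e n a j))
        rw [h, neg_neg]
    have hne : ∀ i : Fin (n + 2), (if (i : ℕ) < 2 then -a i else a i) ≠ 0 := by
      intro i
      have := ha i
      split_ifs <;> linarith [this]
    have h1 := fdiff_comm n a (ee n a i j * m) (ee n a j i)
    rw [← mul_assoc, ee_ee n a j i, hs, neg_mul, mul_assoc, ee_ee, smul_mul_assoc, mul_smul_comm,
      one_mul, mul_one, map_neg, map_smul, map_smul, smul_eq_mul, smul_eq_mul] at h1
    have h2 := mul_ne_zero (hne i) (hne j)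
    have h3 : ((if (i : ℕ) < 2 then -a i else a i) * (if (j : ℕ) < 2 then -a j else a j)) *
      fdiff n a m = 0 := by linarith
    exact (mul_eq_zero.mp h3).resolve_left h2

lemma fdiff_zero (ha : ∀ i, 0 < a i) (x : Cplus n a) : fdiff n a x = 0 := by
  have : Submodule.span ℚ (Mset n a) ≤ LinearMap.ker (fdiff n a) :=
    Submodule.span_le.mpr fun m hm => fdiff_M n a ha m hm
  exact this (mem_span_M n a x)

lemma tau_tau (x : Cplus n a) : tau n a (tau n a x) = x :=
  Subtype.ext (reverse_reverse _)

lemma tau_mul (x y : Cplus n a) : tau n a (x * y) = tau n a y * tau n a x :=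
  Subtype.ext (reverse.map_mul _ _)

/-- `τ` as a linear equivalence. -/
def tauE : Cplus n a ≃ₗ[ℚ] Cplus n a where
  toFun := tau n a
  invFun := tau n a
  map_add' x y := Subtype.ext (map_add reverse _ _)
  map_smul' c x := Subtype.ext (map_smul reverse _ _)
  left_inv := tau_tau n a
  right_inv := tau_tau n a

lemma tr_tau (ha : ∀ i, 0 < a i) (z : Cplus n a) : tr n a (tau n a z) = tr n a z := by
  have h1 : (tauE n a).conj (LinearMap.mulRight ℚ z) = LinearMap.mulLeft ℚ (tau n a z) := by
    ext1 x
    change tau n a (tau n a x * z) = tau n a z * x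
    rw [tau_mul, tau_tau]
  have h2 := fdiff_zero n a ha z
  rw [fdiff_apply, sub_eq_zero] at h2
  rw [tr, tr, ← h1, LinearMap.trace_conj', h2]

lemma tau_lam : tau n a (lam n a) = -lam n a := by
  apply Subtype.ext
  change reverse (e n a 0 * e n a 1) = -(e n a 0 * e n a 1)
  rw [reverse.map_mul, e_anti n a (i := 0) (j := 1) (by simp), neg_neg]
  simp [e, reverse_ι]

/-- The form `⟨,⟩_λ` is alternating: `⟨y,x⟩_λ = −⟨x,y⟩_λ` for all `x, y ∈ C⁺(V)`. -/
theorem statement4 (hn : 1 ≤ n) (ha : ∀ i, 0 < a i) :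
    ∀ x y : Cplus n a, form n a y x = -form n a x y := by
  intro x y
  have h : tau n a (lam n a * tau n a y * x) = -(tau n a x * y * lam n a) := by
    rw [tau_mul, tau_mul, tau_tau, tau_lam, mul_neg, mul_neg, mul_assoc]
  have hneg : ∀ z : Cplus n a, tr n a (-z) = -tr n a z := fun z =>
    map_neg (LinearMap.trace ℚ (Cplus n a) ∘ₗ (LinearMap.mul ℚ (Cplus n a))) z
  rw [form, form, ← tr_tau n a ha, h, hneg, mul_assoc (lam n a)]
  exact congrArg _ (trL_comm n a _ _)
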